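/- arXiv:2105.13511 — 2 statements merged into one kernel-verified Lean document; each statement's English description precedes it below -/
import Mathlib

section
/- Let ε > 0 satisfy 2Mε/μ < 1, and let (a_n)_{n≥0} be a sequence in ℝ^d with 0 < δ_0 < μ/M, where δ_n := ‖a_n − a⋆‖, such that every update has error at most ε: ‖a_{n+1} − (a_n − (H_F(a_n))⁻¹ g_F(a_n))‖ ≤ ε for all n ≥ 0. Define n_it := max{ ⌈log₂( log(2Mε/μ) / (2 log(Mδ_0/μ)) )⌉ + 1, 1 }. Then δ_n ≤ 2ε for every n ≥ n_it. -/
open scoped RealInnerProductSpace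

section NewtonStep

variable {E : Type*} [NormedAddCommGroup E] [InnerProductSpace ℝ E]

/-- The derivative of a strongly monotone map is coercive. -/
theorem HasFDerivAt.mul_norm_sq_le_inner_of_stronglyMonotone {g : E → E} {g' : E →L[ℝ] E}
    {x : E} {μ : ℝ} (hg : HasFDerivAt g g' x)
    (hmono : ∀ a b, μ * ‖a - b‖ ^ 2 ≤ ⟪g a - g b, a - b⟫) (v : E) :
    μ * ‖v‖ ^ 2 ≤ ⟪g' v, v⟫ := by
  have hline : HasDerivAt (fun t : ℝ => g (x + t • v)) (g' v) 0 := by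
    have h : HasDerivAt (fun t : ℝ => x + t • v) v 0 := by
      simpa using ((hasDerivAt_id (0 : ℝ)).smul_const v).const_add x
    exact HasFDerivAt.comp_hasDerivAt (0 : ℝ) (by simpa using hg) h
  have hlim := hline.tendsto_slope_zero_right.inner (𝕜 := ℝ) (tendsto_const_nhds (x := v))
  refine ge_of_tendsto hlim ?_
  filter_upwards [self_mem_nhdsWithin] with t ht
  have ht : 0 < t := ht
  have h := hmono (x + t • v) x
  simp only [add_sub_cancel_left, norm_smul, inner_smul_right, Real.norm_eq_abs,
    _root_.abs_of_pos ht] at h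
  simp only [zero_add, zero_smul, add_zero, real_inner_smul_left]
  rw [inv_mul_eq_div, le_div_iff₀ ht]
  nlinarith

/-- Quadratic bound on the first-order Taylor remainder of a map with Lipschitz derivative. -/
theorem norm_taylor_remainder_le_of_lipschitz_fderiv {g : E → E} {g' : E → E →L[ℝ] E} {M : ℝ}
    (hg : ∀ x, HasFDerivAt g (g' x) x) (hLip : ∀ a b, ‖g' a - g' b‖ ≤ M * ‖a - b‖) (x v : E) :
    ‖g (x + v) - g x - g' x v‖ ≤ M / 2 * ‖v‖ ^ 2 := by
  have hf : ∀ t : ℝ, HasDerivAt (fun t : ℝ => g (x + t • v) - g x - t • g' x v)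
      (g' (x + t • v) v - g' x v) t := by
    intro t
    have h : HasDerivAt (fun t : ℝ => x + t • v) v t := by
      simpa using ((hasDerivAt_id t).smul_const v).const_add x
    have h₁ : HasDerivAt (fun t : ℝ => g (x + t • v)) (g' (x + t • v) v) t :=
      (hg (x + t • v)).comp_hasDerivAt t h
    have h₂ : HasDerivAt (fun t : ℝ => t • g' x v) (g' x v) t := by
      simpa using (hasDerivAt_id t).smul_const (g' x v)
    exact (h₁.sub_const (g x)).sub h₂
  have hB : ∀ t : ℝ, HasDerivAt (fun t : ℝ => M / 2 * ‖v‖ ^ 2 * t ^ 2) (M * ‖v‖ ^ 2 * t) t := by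
    intro t
    refine ((hasDerivAt_pow 2 t).const_mul (M / 2 * ‖v‖ ^ 2)).congr_deriv ?_
    push_cast
    ring
  have key := image_norm_le_of_norm_deriv_right_le_deriv_boundary (a := 0) (b := 1)
    (fun t _ => (hf t).continuousAt.continuousWithinAt) (fun t _ => (hf t).hasDerivWithinAt)
    (by simp) hB (fun t ht => ?_) (Set.right_mem_Icc.2 zero_le_one)
  · simpa using key
  · calc ‖g' (x + t • v) v - g' x v‖ = ‖(g' (x + t • v) - g' x) v‖ := by simp
      _ ≤ ‖g' (x + t • v) - g' x‖ * ‖v‖ := ContinuousLinearMap.le_opNorm _ _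
      _ ≤ M * ‖x + t • v - x‖ * ‖v‖ := by gcongr; exact hLip _ _
      _ = M * ‖v‖ ^ 2 * t := by
        rw [add_sub_cancel_left, norm_smul, Real.norm_eq_abs, abs_of_nonneg ht.1]
        ring

theorem norm_le_mul_of_coercive {A : E →L[ℝ] E} {μ : ℝ}
    (hA : ∀ v, μ * ‖v‖ ^ 2 ≤ ⟪A v, v⟫) (v : E) : μ * ‖v‖ ≤ ‖A v‖ := by
  rcases (norm_nonneg v).eq_or_lt with h | h
  · simp [← h]
  · have := (hA v).trans (real_inner_le_norm _ _)
    nlinarith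

theorem isInvertible_of_coercive [FiniteDimensional ℝ E] {A : E →L[ℝ] E} {μ : ℝ} (hμ : 0 < μ)
    (hA : ∀ v, μ * ‖v‖ ^ 2 ≤ ⟪A v, v⟫) : A.IsInvertible := by
  have hinj : Function.Injective A := by
    refine (injective_iff_map_eq_zero A).2 fun v hv => ?_
    have h := norm_le_mul_of_coercive hA v
    rw [hv, norm_zero] at h
    exact norm_le_zero_iff.1 (nonpos_of_mul_nonpos_right h hμ)
  exact ⟨(LinearEquiv.ofInjectiveEndo A.toLinearMap hinj).toContinuousLinearEquiv, by ext; rfl⟩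

/-- Quadratic convergence of one exact Newton step towards a zero of `g`. -/
theorem norm_newton_step_sub_le [FiniteDimensional ℝ E] {g : E → E} {g' : E → E →L[ℝ] E}
    {μ M : ℝ} (hμ : 0 < μ) (hg : ∀ x, HasFDerivAt g (g' x) x)
    (hcoer : ∀ x v, μ * ‖v‖ ^ 2 ≤ ⟪g' x v, v⟫)
    (hLip : ∀ a b, ‖g' a - g' b‖ ≤ M * ‖a - b‖) {z : E} (hz : g z = 0) (x : E) :
    ‖x - (g' x).inverse (g x) - z‖ ≤ M / (2 * μ) * ‖x - z‖ ^ 2 := by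
  have hinv := isInvertible_of_coercive hμ (hcoer x)
  have hstep : g' x (x - (g' x).inverse (g x) - z) = g (x + (z - x)) - g x - g' x (z - x) := by
    have h : g' x ((g' x).inverse (g x)) = g x := hinv.self_apply_inverse _
    simp only [map_sub, h, add_sub_cancel, hz]
    abel
  have h₁ := norm_le_mul_of_coercive (hcoer x) (x - (g' x).inverse (g x) - z)
  have h₂ := norm_taylor_remainder_le_of_lipschitz_fderiv hg hLip x (z - x)
  rw [← hstep, norm_sub_rev z x] at h₂
  calc _ ≤ M / 2 * ‖x - z‖ ^ 2 / μ := by rw [le_div_iff₀ hμ]; linarith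
    _ = _ := by field_simp

end NewtonStep

theorem le_max_pow_two_pow_of_le_half_sq_add {x : ℕ → ℝ} {e : ℝ} (hx : ∀ n, 0 ≤ x n)
    (he₀ : 0 ≤ e) (he₁ : e ≤ 1) (hstep : ∀ n, x (n + 1) ≤ x n ^ 2 / 2 + e / 2) (n : ℕ) :
    x n ≤ max (x 0 ^ 2 ^ n) e := by
  induction n with
  | zero => simp
  | succ n ih =>
    have hs := hstep n
    have hn := hx n
    rcases le_max_iff.1 ih with h | h
    · have hsq : x n ^ 2 ≤ x 0 ^ 2 ^ (n + 1) := by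
        rw [pow_succ 2, pow_mul]
        gcongr
      linarith [le_max_left (x 0 ^ 2 ^ (n + 1)) e, le_max_right (x 0 ^ 2 ^ (n + 1)) e]
    · exact le_max_of_le_right (by nlinarith)

theorem pow_two_pow_le_of_ceil_logb_le {y e : ℝ} (hy₀ : 0 < y) (hy₁ : y < 1) (he₀ : 0 < e)
    (he₁ : e < 1) {n : ℕ}
    (hn : ⌈Real.logb 2 (Real.log e / (2 * Real.log y))⌉ + 1 ≤ (n : ℤ)) : y ^ 2 ^ n ≤ e := by
  have hly := Real.log_neg hy₀ hy₁
  have hle := Real.log_neg he₀ he₁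
  have h₁ : Real.logb 2 (Real.log e / (2 * Real.log y)) ≤ (n : ℝ) - 1 := by
    have := Int.ceil_le.1 (le_sub_iff_add_le.2 hn)
    exact_mod_cast this
  rw [Real.logb_le_iff_le_rpow one_lt_two (div_pos_of_neg_of_neg hle (by linarith)),
    Real.rpow_sub_one two_ne_zero, Real.rpow_natCast, div_le_iff_of_neg (by linarith)] at h₁
  rw [← Real.log_le_log_iff (by positivity) he₀, Real.log_pow]
  push_cast
  linarith

/-- Convergence of Newton's method with `ε`-bounded update
errors: if `2Mε/μ < 1` and `0 < δ₀ < μ/M`, then `δ_n ≤ 2ε` for every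
`n ≥ n_it := max (⌈log₂( log(2Mε/μ) / (2 log(Mδ₀/μ)) )⌉ + 1) 1`. -/
theorem stmt11 (d : ℕ) (hd : 1 ≤ d)
    (F : EuclideanSpace ℝ (Fin d) → ℝ) (hF : ContDiff ℝ 2 F)
    (μ M : ℝ) (hμ : 0 < μ) (hM : 0 < M)
    (hconv : ∀ a b : EuclideanSpace ℝ (Fin d),
      F a ≥ F b + ⟪gradient F b, a - b⟫ + μ / 2 * ‖a - b‖ ^ 2)
    (H : EuclideanSpace ℝ (Fin d) →
      (EuclideanSpace ℝ (Fin d) →L[ℝ] EuclideanSpace ℝ (Fin d)))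
    (hH : ∀ x, HasFDerivAt (gradient F) (H x) x)
    (hLip : ∀ a b : EuclideanSpace ℝ (Fin d), ‖H a - H b‖ ≤ M * ‖a - b‖)
    (astar : EuclideanSpace ℝ (Fin d)) (hmin : ∀ x, F astar ≤ F x)
    (hmin_unique : ∀ b, (∀ x, F b ≤ F x) → b = astar)
    (ε : ℝ) (hε : 0 < ε) (hεcond : 2 * M * ε / μ < 1)
    (a : ℕ → EuclideanSpace ℝ (Fin d))
    (hδ0pos : 0 < ‖a 0 - astar‖) (hδ0 : ‖a 0 - astar‖ < μ / M)
    (hupd : ∀ n : ℕ,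
      ‖a (n + 1) - (a n - (H (a n)).inverse (gradient F (a n)))‖ ≤ ε) :
    ∀ n : ℕ,
      (max (⌈Real.logb 2 (Real.log (2 * M * ε / μ) /
          (2 * Real.log (M * ‖a 0 - astar‖ / μ)))⌉ + 1) 1 : ℤ) ≤ (n : ℤ) →
      ‖a n - astar‖ ≤ 2 * ε := by
  have hdiff : Differentiable ℝ F := hF.differentiable two_ne_zero
  have hmono : ∀ x y, μ * ‖x - y‖ ^ 2 ≤ ⟪gradient F x - gradient F y, x - y⟫ := by
    intro x y
    have h₁ := hconv x y
    have h₂ := hconv y x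
    rw [← neg_sub x y, inner_neg_right, norm_neg] at h₂
    rw [inner_sub_left]
    linarith
  have hz : gradient F astar = 0 := by
    have hmin' : IsLocalMin F astar := Filter.Eventually.of_forall hmin
    simp [gradient, hmin'.fderiv_eq_zero]
  have hstep : ∀ n, ‖a (n + 1) - astar‖ ≤ M / (2 * μ) * ‖a n - astar‖ ^ 2 + ε := by
    intro n
    have h := norm_newton_step_sub_le hμ hH
      (fun x => (hH x).mul_norm_sq_le_inner_of_stronglyMonotone hmono) hLip hz (a n)
    have h' := norm_sub_le_norm_sub_add_norm_sub (a (n + 1))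
      (a n - (H (a n)).inverse (gradient F (a n))) astar
    linarith [hupd n]
  intro n hn
  have he₀ : 0 < 2 * M * ε / μ := by positivity
  have hy₀ : 0 < M * ‖a 0 - astar‖ / μ := by positivity
  have hy₁ : M * ‖a 0 - astar‖ / μ < 1 := by
    rw [lt_div_iff₀ hM] at hδ0
    rw [div_lt_one hμ]
    linarith
  have hx := le_max_pow_two_pow_of_le_half_sq_add (x := fun n => M * ‖a n - astar‖ / μ)
    (fun n => by positivity) he₀.le hεcond.le (fun n => by
      calc M * ‖a (n + 1) - astar‖ / μ
          ≤ M * (M / (2 * μ) * ‖a n - astar‖ ^ 2 + ε) / μ := by gcongr; exact hstep n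
        _ = (M * ‖a n - astar‖ / μ) ^ 2 / 2 + 2 * M * ε / μ / 2 := by field_simp) n
  have hpow := pow_two_pow_le_of_ceil_logb_le hy₀ hy₁ he₀ hεcond ((le_max_left _ _).trans hn)
  have hx' := hx.trans (max_le hpow le_rfl)
  simp only [div_le_div_iff_of_pos_right hμ] at hx'
  exact le_of_mul_le_mul_left (by linarith) hM
end

section
/- Let ε > 0 satisfy 2Mε/μ < 1 and define δ_± := (μ/M)(1 ± √(1 − 2Mε/μ)). Let a_0 ∈ ℝ^d satisfy δ_0 := ‖a_0 − a⋆‖ < δ_+, and set δ̃_0 := max{δ_0, δ_−}. Suppose a sequence (a_n)_{n≥0} is generated by the updates a_{n+1} = a_n − (Ĥ_n)⁻¹ ĝ_n, where at each step n the vector ĝ_n satisfies |(ĝ_n)_i − (g_F(a_n))_i| ≤ ε′_g componentwise and the symmetric matrix Ĥ_n satisfies |(Ĥ_n)_{ij} − (H_F(a_n))_{ij}| ≤ ε′_H entrywise, with ε′_g ≤ με/(2√d) and ε′_H ≤ με/(4 δ̃_0 d). Then each Ĥ_n is invertible and ‖(Ĥ_n)⁻¹ ĝ_n − (H_F(a_n))⁻¹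 g_F(a_n)‖ ≤ ε for every n ≥ 0. -/
open scoped RealInnerProductSpace

section NormBounds

variable {ι : Type*} [Fintype ι]

lemma EuclideanSpace.norm_le_sqrt_card_mul {v : EuclideanSpace ℝ ι} {c : ℝ} (hc : 0 ≤ c)
    (h : ∀ i, |v i| ≤ c) : ‖v‖ ≤ √(Fintype.card ι) * c := by
  rw [EuclideanSpace.norm_eq]
  refine Real.sqrt_le_iff.2 ⟨by positivity, ?_⟩
  rw [mul_pow, Real.sq_sqrt (Nat.cast_nonneg _)]
  calc ∑ i, ‖v i‖ ^ 2 ≤ ∑ _i : ι, c ^ 2 :=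
        Finset.sum_le_sum fun i _ => pow_le_pow_left₀ (norm_nonneg _) (h i) 2
    _ = Fintype.card ι * c ^ 2 := by simp

lemma EuclideanSpace.sum_abs_le_sqrt_card_mul_norm (v : EuclideanSpace ℝ ι) :
    ∑ i, |v i| ≤ √(Fintype.card ι) * ‖v‖ := by
  refine abs_le_of_sq_le_sq' ?_ (by positivity) |>.2
  rw [mul_pow, Real.sq_sqrt (Nat.cast_nonneg _), EuclideanSpace.norm_sq_eq]
  simpa using sq_sum_le_card_mul_sum_sq (s := Finset.univ) (f := fun i => |v i|)

variable [DecidableEq ι]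

lemma Matrix.norm_toEuclideanCLM_apply_le_of_abs_le {A : Matrix ι ι ℝ} {c : ℝ} (hc : 0 ≤ c)
    (h : ∀ i j, |A i j| ≤ c) (v : EuclideanSpace ℝ ι) :
    ‖Matrix.toEuclideanCLM (𝕜 := ℝ) A v‖ ≤ Fintype.card ι * c * ‖v‖ := by
  have key : ∀ i, |Matrix.toEuclideanCLM (𝕜 := ℝ) A v i| ≤ c * (√(Fintype.card ι) * ‖v‖) := by
    intro i
    calc |Matrix.toEuclideanCLM (𝕜 := ℝ) A v i| = |∑ j, A i j * v j| := by
          rw [Matrix.ofLp_toEuclideanCLM]; rfl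
      _ ≤ ∑ j, |A i j * v j| := Finset.abs_sum_le_sum_abs _ _
      _ ≤ ∑ j, c * |v j| := Finset.sum_le_sum fun j _ => by
          rw [abs_mul]; exact mul_le_mul_of_nonneg_right (h i j) (abs_nonneg _)
      _ ≤ c * (√(Fintype.card ι) * ‖v‖) := by
          rw [← Finset.mul_sum]
          exact mul_le_mul_of_nonneg_left (EuclideanSpace.sum_abs_le_sqrt_card_mul_norm v) hc
  calc _ ≤ √(Fintype.card ι) * (c * (√(Fintype.card ι) * ‖v‖)) :=
        EuclideanSpace.norm_le_sqrt_card_mul (by positivity) key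
    _ = √(Fintype.card ι) * √(Fintype.card ι) * c * ‖v‖ := by ring
    _ = _ := by rw [Real.mul_self_sqrt (Nat.cast_nonneg _)]

lemma Matrix.isUnit_det_of_le_norm_toEuclideanCLM {A : Matrix ι ι ℝ} {m : ℝ} (hm : 0 < m)
    (h : ∀ v, m * ‖v‖ ≤ ‖Matrix.toEuclideanCLM (𝕜 := ℝ) A v‖) : IsUnit A.det := by
  rw [isUnit_iff_ne_zero]
  intro h0
  obtain ⟨v, hv, hAv⟩ := Matrix.exists_mulVec_eq_zero_iff.2 h0
  have h1 := h (WithLp.toLp 2 v)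
  rw [Matrix.toEuclideanCLM_toLp, hAv, WithLp.toLp_zero, norm_zero] at h1
  have h2 : ‖WithLp.toLp 2 v‖ ≤ 0 := by
    by_contra! h3
    exact absurd h1 (not_le.2 (mul_pos hm h3))
  exact hv (by simpa using h2)

lemma Matrix.toEuclideanCLM_inv_apply_self {A : Matrix ι ι ℝ} (hA : IsUnit A.det)
    (v : EuclideanSpace ℝ ι) :
    Matrix.toEuclideanCLM (𝕜 := ℝ) A⁻¹ (Matrix.toEuclideanCLM (𝕜 := ℝ) A v) = v := by
  rw [← mul_apply_eq_comp, ← map_mul, Matrix.nonsing_inv_mul _ hA, map_one]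
  rfl

lemma Matrix.toEuclideanCLM_apply_inv_self {A : Matrix ι ι ℝ} (hA : IsUnit A.det)
    (v : EuclideanSpace ℝ ι) :
    Matrix.toEuclideanCLM (𝕜 := ℝ) A (Matrix.toEuclideanCLM (𝕜 := ℝ) A⁻¹ v) = v := by
  rw [← mul_apply_eq_comp, ← map_mul, Matrix.mul_nonsing_inv _ hA, map_one]
  rfl

end NormBounds

section Calculus

variable {E : Type*} [NormedAddCommGroup E] [NormedSpace ℝ E]

lemma norm_le_norm_hasFDerivAt_of_expanding {G : E → E} {G' : E →L[ℝ] E} {x : E} {μ : ℝ}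
    (hG : HasFDerivAt G G' x) (h : ∀ a b, μ * ‖a - b‖ ≤ ‖G a - G b‖) (v : E) :
    μ * ‖v‖ ≤ ‖G' v‖ := by
  have hlim := (hG.hasLineDerivAt v).tendsto_slope_zero.norm
  refine ge_of_tendsto hlim ?_
  filter_upwards [self_mem_nhdsWithin] with t ht
  have ht' : 0 < |t| := abs_pos.2 ht
  have h1 := h (x + t • v) x
  simp only [add_sub_cancel_left, norm_smul, Real.norm_eq_abs] at h1
  simp only [norm_smul, norm_inv, Real.norm_eq_abs]
  rw [inv_mul_eq_div, le_div_iff₀ ht']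
  linarith

lemma norm_sub_sub_fderiv_le_of_lipschitz {G : E → E} {G' : E → E →L[ℝ] E} {M : ℝ}
    (hG : ∀ x, HasFDerivAt G (G' x) x) (h : ∀ a b, ‖G' a - G' b‖ ≤ M * ‖a - b‖) (x v : E) :
    ‖G (x + v) - G x - G' x v‖ ≤ M / 2 * ‖v‖ ^ 2 := by
  have hline : ∀ t : ℝ, HasDerivAt (fun t : ℝ => x + t • v) v t := fun t => by
    simpa using ((hasDerivAt_id t).smul_const v).const_add x
  have hf : ∀ t : ℝ, HasDerivAt (fun t : ℝ => G (x + t • v) - G x - t • G' x v)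
      (G' (x + t • v) v - G' x v) t := fun t => by
    simpa using (((hG (x + t • v)).comp_hasDerivAt t (hline t)).sub_const (G x)).fun_sub
      ((hasDerivAt_id t).smul_const (G' x v))
  have hB : ∀ t : ℝ, HasDerivAt (fun t : ℝ => M / 2 * ‖v‖ ^ 2 * t ^ 2) (M * ‖v‖ ^ 2 * t) t :=
    fun t => ((hasDerivAt_pow 2 t).const_mul (M / 2 * ‖v‖ ^ 2)).congr_deriv (by push_cast; ring)
  have := image_norm_le_of_norm_deriv_right_le_deriv_boundary (a := (0 : ℝ)) (b := 1)
    (fun t _ => (hf t).continuousAt.continuousWithinAt) (fun t _ => (hf t).hasDerivWithinAt)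
    (by simp) hB (fun t ht => by
      calc ‖G' (x + t • v) v - G' x v‖ = ‖(G' (x + t • v) - G' x) v‖ := rfl
        _ ≤ ‖G' (x + t • v) - G' x‖ * ‖v‖ := ContinuousLinearMap.le_opNorm _ _
        _ ≤ M * ‖x + t • v - x‖ * ‖v‖ := by gcongr; exact h _ _
        _ = M * ‖v‖ ^ 2 * t := by
          rw [add_sub_cancel_left, norm_smul, Real.norm_of_nonneg ht.1]; ring)
    (Set.right_mem_Icc.2 zero_le_one)
  simpa using this

end Calculus

lemma norm_sub_le_norm_gradient_sub_of_strongConvex {E : Type*} [NormedAddCommGroup E]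
    [InnerProductSpace ℝ E] [CompleteSpace E] {F : E → ℝ} {μ : ℝ}
    (h : ∀ a b : E, F a ≥ F b + ⟪gradient F b, a - b⟫ + μ / 2 * ‖a - b‖ ^ 2) (a b : E) :
    μ * ‖a - b‖ ≤ ‖gradient F a - gradient F b‖ := by
  have h1 := h a b
  have h2 := h b a
  have h3 : ⟪gradient F a, b - a⟫ = -⟪gradient F a, a - b⟫ := by
    rw [← inner_neg_right, neg_sub]
  rw [norm_sub_rev b a, h3] at h2
  have h4 := real_inner_le_norm (gradient F a - gradient F b) (a - b)
  rw [inner_sub_left] at h4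
  rcases (norm_nonneg (a - b)).eq_or_lt with h0 | h0
  · rw [← h0]; simp
  · refine le_of_mul_le_mul_right ?_ h0
    nlinarith

lemma IsLocalMin.gradient_eq_zero {E : Type*} [NormedAddCommGroup E]
    [InnerProductSpace ℝ E] [CompleteSpace E] {F : E → ℝ} {x : E} (h : IsLocalMin F x) :
    gradient F x = 0 := by
  rw [gradient, h.fderiv_eq_zero, map_zero]

/-- Perturbation bound for the solution of a linear system. -/
lemma norm_sub_le_of_perturbed_system {E : Type*} [NormedAddCommGroup E] [NormedSpace ℝ E]
    {A A' : E →L[ℝ] E} {p q g g' : E} {m κ η R ε : ℝ} (hκm : κ < m) (hκ : 0 ≤ κ)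
    (hA : ∀ v, m * ‖v‖ ≤ ‖A v‖) (hAA' : ∀ v, ‖A' v - A v‖ ≤ κ * ‖v‖) (hg : ‖g' - g‖ ≤ η)
    (hp : A p = g) (hq : A' q = g') (hR : ‖p‖ ≤ R) (hε : η + κ * R ≤ (m - κ) * ε) :
    ‖q - p‖ ≤ ε := by
  refine le_of_mul_le_mul_left ?_ (sub_pos.2 hκm)
  have h1 : A (q - p) = (g' - g) - (A' p - A p) - (A' (q - p) - A (q - p)) := by
    rw [map_sub, map_sub, hp, hq]; abel
  have h2 : ‖A (q - p)‖ ≤ η + κ * R + κ * ‖q - p‖ := by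
    rw [h1]
    refine (norm_sub_le _ _).trans (add_le_add ((norm_sub_le _ _).trans (add_le_add hg ?_))
      (hAA' _))
    exact (hAA' p).trans (mul_le_mul_of_nonneg_left hR hκ)
  linarith [hA (q - p)]

/-- `μ / M * (1 ± √(1 - 2 M ε / μ))` are the roots of `M δ² / (2 μ) + ε = δ`. -/
lemma newton_radius_stable {μ M ε δ : ℝ} (hμ : 0 < μ) (hM : 0 < M) (hε : 2 * M * ε / μ < 1)
    (hlo : μ / M * (1 - √(1 - 2 * M * ε / μ)) ≤ δ)
    (hhi : δ ≤ μ / M * (1 + √(1 - 2 * M * ε / μ))) :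
    M / 2 * δ ^ 2 + μ * ε ≤ μ * δ := by
  set s := √(1 - 2 * M * ε / μ) with hs
  have hs2 : s ^ 2 = 1 - 2 * M * ε / μ := Real.sq_sqrt (by linarith)
  have hs3 : μ ^ 2 * s ^ 2 = μ ^ 2 - 2 * M * ε * μ := by rw [hs2]; field_simp
  have h1 : μ * (1 - s) ≤ M * δ := by
    rw [div_mul_eq_mul_div, div_le_iff₀ hM] at hlo; linarith
  have h2 : M * δ ≤ μ * (1 + s) := by
    rw [div_mul_eq_mul_div, le_div_iff₀ hM] at hhi; linarith
  have h3 := mul_nonneg (sub_nonneg.2 h1) (sub_nonneg.2 h2)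
  refine le_of_mul_le_mul_left ?_ hM
  nlinarith

/-- Accuracy requirement along the whole approximate Newton
iteration: with `2Mε/μ < 1`, `δ_± = (μ/M)(1 ± √(1 − 2Mε/μ))`,
`δ₀ := ‖a₀ − a⋆‖ < δ_+`, `δ̃₀ := max δ₀ δ_−`, if the iterates are generated by
`a_{n+1} = a_n − Ĥ_n⁻¹ ĝ_n` where `ĝ_n` approximates `g_F(a_n)` componentwise
within `ε′_g ≤ με/(2√d)` and the symmetric `Ĥ_n` approximates `H_F(a_n)`
entrywise within `ε′_H ≤ με/(4δ̃₀d)`, then each `Ĥ_n` is invertible and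
`‖Ĥ_n⁻¹ ĝ_n − (H_F(a_n))⁻¹ g_F(a_n)‖ ≤ ε` for every `n`. -/
theorem stmt16 (d : ℕ) (hd : 1 ≤ d)
    (F : EuclideanSpace ℝ (Fin d) → ℝ) (hF : ContDiff ℝ 2 F)
    (μ M : ℝ) (hμ : 0 < μ) (hM : 0 < M)
    (hconv : ∀ a b : EuclideanSpace ℝ (Fin d),
      F a ≥ F b + ⟪gradient F b, a - b⟫ + μ / 2 * ‖a - b‖ ^ 2)
    (H : EuclideanSpace ℝ (Fin d) → Matrix (Fin d) (Fin d) ℝ)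
    (hH : ∀ x, HasFDerivAt (gradient F) (Matrix.toEuclideanCLM (𝕜 := ℝ) (H x)) x)
    (hLip : ∀ a b : EuclideanSpace ℝ (Fin d),
      ‖Matrix.toEuclideanCLM (𝕜 := ℝ) (H a - H b)‖ ≤ M * ‖a - b‖)
    (astar : EuclideanSpace ℝ (Fin d)) (hmin : ∀ x, F astar ≤ F x)
    (hmin_unique : ∀ b, (∀ x, F b ≤ F x) → b = astar)
    (ε : ℝ) (hε : 0 < ε) (hεcond : 2 * M * ε / μ < 1)
    (a : ℕ → EuclideanSpace ℝ (Fin d))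
    (ha0 : ‖a 0 - astar‖ < μ / M * (1 + Real.sqrt (1 - 2 * M * ε / μ)))
    (εg εH : ℝ)
    (hεg : εg ≤ μ * ε / (2 * Real.sqrt d))
    (hεH : εH ≤ μ * ε /
      (4 * max ‖a 0 - astar‖ (μ / M * (1 - Real.sqrt (1 - 2 * M * ε / μ))) * d))
    (ghat : ℕ → EuclideanSpace ℝ (Fin d))
    (Hhat : ℕ → Matrix (Fin d) (Fin d) ℝ)
    (hghat : ∀ n i, |ghat n i - gradient F (a n) i| ≤ εg)
    (hHhatsymm : ∀ n, (Hhat n).IsSymm)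
    (hHhat : ∀ n i j, |Hhat n i j - H (a n) i j| ≤ εH)
    (hupd : ∀ n : ℕ,
      a (n + 1) = a n - Matrix.toEuclideanCLM (𝕜 := ℝ) (Hhat n)⁻¹ (ghat n)) :
    ∀ n : ℕ, IsUnit (Hhat n).det ∧
      ‖Matrix.toEuclideanCLM (𝕜 := ℝ) (Hhat n)⁻¹ (ghat n) -
        Matrix.toEuclideanCLM (𝕜 := ℝ) (H (a n))⁻¹ (gradient F (a n))‖ ≤ ε := by
  have i₀ : Fin d := ⟨0, hd⟩
  have hd0 : (0 : ℝ) < d := by exact_mod_cast hd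
  set G := gradient F
  set L := fun A : Matrix (Fin d) (Fin d) ℝ => Matrix.toEuclideanCLM (𝕜 := ℝ) A with hL
  set s := √(1 - 2 * M * ε / μ) with hs
  set δ := max ‖a 0 - astar‖ (μ / M * (1 - s))
  have hG0 : G astar = 0 := IsLocalMin.gradient_eq_zero (Filter.Eventually.of_forall hmin)
  have hs0 : 0 ≤ s := Real.sqrt_nonneg _
  have hs1 : s < 1 := by
    rw [hs, Real.sqrt_lt' one_pos]
    have : 0 < 2 * M * ε / μ := by positivity
    linarith
  have hδpos : 0 < δ := lt_max_of_lt_right (mul_pos (by positivity) (by linarith))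
  have hquad : M / 2 * δ ^ 2 + μ * ε ≤ μ * δ :=
    newton_radius_stable hμ hM hεcond (le_max_right _ _)
      (max_le ha0.le (mul_le_mul_of_nonneg_left (by linarith) (by positivity)))
  have hεg0 : 0 ≤ εg := (abs_nonneg _).trans (hghat 0 i₀)
  have hεH0 : 0 ≤ εH := (abs_nonneg _).trans (hHhat 0 i₀ i₀)
  have hg : ∀ n, ‖ghat n - G (a n)‖ ≤ μ * ε / 2 := fun n => by
    have h1 := EuclideanSpace.norm_le_sqrt_card_mul (v := ghat n - G (a n)) hεg0 (hghat n)
    rw [Fintype.card_fin] at h1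
    refine h1.trans ((mul_le_mul_of_nonneg_left hεg (Real.sqrt_nonneg _)).trans_eq ?_)
    have := Real.sqrt_pos.2 hd0
    field_simp
  set κ := d * εH with hκdef
  have hκ0 : 0 ≤ κ := by positivity
  have hκ : 4 * δ * κ ≤ μ * ε := by
    rw [le_div_iff₀ (by positivity)] at hεH
    rw [hκdef]; linarith
  have hpert : ∀ n v, ‖L (Hhat n) v - L (H (a n)) v‖ ≤ κ * ‖v‖ := fun n v => by
    have h1 := Matrix.norm_toEuclideanCLM_apply_le_of_abs_le (A := Hhat n - H (a n)) hεH0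
      (hHhat n) v
    rwa [Fintype.card_fin, map_sub, sub_apply] at h1
  have hlow : ∀ x v, μ * ‖v‖ ≤ ‖L (H x) v‖ := fun x v =>
    norm_le_norm_hasFDerivAt_of_expanding (hH x)
      (norm_sub_le_norm_gradient_sub_of_strongConvex hconv) v
  have hεδ : ε < δ := by
    have : 0 < M / 2 * δ ^ 2 := by positivity
    exact lt_of_mul_lt_mul_left (by linarith) hμ.le
  have hκμ : κ < μ := by
    have h1 : μ * ε < 4 * δ * μ := by nlinarith
    exact lt_of_mul_lt_mul_left (hκ.trans_lt h1) (by positivity)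
  have hdetH : ∀ x, IsUnit (H x).det := fun x =>
    Matrix.isUnit_det_of_le_norm_toEuclideanCLM hμ (hlow x)
  have hdet : ∀ n, IsUnit (Hhat n).det := fun n =>
    Matrix.isUnit_det_of_le_norm_toEuclideanCLM (sub_pos.2 hκμ) fun v => by
      have h1 := norm_sub_norm_le (L (H (a n)) v) (L (Hhat n) v)
      rw [norm_sub_rev] at h1
      have h2 := hpert n v
      have h3 := hlow (a n) v
      change (μ - κ) * ‖v‖ ≤ ‖L (Hhat n) v‖
      linarith
  have hnewton : ∀ x, ‖x - astar‖ ≤ δ →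
      ‖L (H x)⁻¹ (G x) - (x - astar)‖ ≤ M / 2 * δ ^ 2 / μ := fun x hx => by
    have h1 := norm_sub_sub_fderiv_le_of_lipschitz hH
      (fun a b => by rw [← map_sub]; exact hLip a b) x (astar - x)
    rw [add_sub_cancel, hG0, norm_sub_rev astar x] at h1
    rw [le_div_iff₀ hμ, mul_comm]
    refine (hlow x _).trans ?_
    have h2 : L (H x) (L (H x)⁻¹ (G x) - (x - astar)) = -(0 - G x - L (H x) (astar - x)) := by
      have h3 : L (H x) (L (H x)⁻¹ (G x)) = G x :=
        Matrix.toEuclideanCLM_apply_inv_self (hdetH x) _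
      rw [map_sub, h3, ← neg_sub x astar, map_neg]; abel
    rw [h2, norm_neg]
    exact h1.trans (by gcongr)
  have herr : ∀ n, ‖a n - astar‖ ≤ δ →
      ‖L (Hhat n)⁻¹ (ghat n) - L (H (a n))⁻¹ (G (a n))‖ ≤ ε := fun n hn => by
    have hR : ‖L (H (a n))⁻¹ (G (a n))‖ ≤ M / 2 * δ ^ 2 / μ + δ :=
      (norm_le_norm_sub_add _ (a n - astar)).trans (add_le_add (hnewton _ hn) hn)
    refine norm_sub_le_of_perturbed_system hκμ hκ0 (hlow (a n)) (hpert n) (hg n)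
      (Matrix.toEuclideanCLM_apply_inv_self (hdetH _) _)
      (Matrix.toEuclideanCLM_apply_inv_self (hdet _) _) hR ?_
    have h1 : M / 2 * δ ^ 2 / μ + ε ≤ δ := by
      rw [← le_sub_iff_add_le, div_le_iff₀ hμ]; linarith
    have h2 : κ * (M / 2 * δ ^ 2 / μ + ε) ≤ κ * δ := mul_le_mul_of_nonneg_left h1 hκ0
    linarith
  have hstay : ∀ n, ‖a n - astar‖ ≤ δ := fun n => by
    induction n with
    | zero => exact le_max_left _ _
    | succ n ih =>
      have h1 : a (n + 1) - astar = -((L (Hhat n)⁻¹ (ghat n) - L (H (a n))⁻¹ (G (a n))) +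
          (L (H (a n))⁻¹ (G (a n)) - (a n - astar))) := by
        rw [hupd n]; simp only [hL]; abel
      rw [h1, norm_neg]
      refine (norm_add_le _ _).trans ((add_le_add (herr n ih) (hnewton _ ih)).trans ?_)
      rw [← le_sub_iff_add_le', div_le_iff₀ hμ]; linarith
  exact fun n => ⟨hdet n, herr n (hstay n)⟩
end
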